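/- arXiv:1909.00844 — 4 statements merged into one kernel-verified Lean document; each statement's English description precedes it below -/
import Mathlib

section
/- Let G be a finite simple graph with vertex set V of size n ≥ 4, let λ ≥ 1 be a real number such that every nonempty proper subset S' of V satisfies |C(S')| ≥ λ, and let ε ∈ (0,1] be a real number. Let S ⊆ V with |S| ≥ 2 and S ≠ V, and suppose |C(S)| ≤ (2-ε)·λ. Then for every vertex v ∈ S, one has 2·c_S(v) ≤ (1-ε)·λ + d(v), and consequently c_S(v) ≤ (1 - ε/2)·d(v). -/
/-- The cut `C(S)`: the set of edges of `G` with exactly one endpoint in `S`. -/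
def SimpleGraph.cutEdges {V : Type*} [Fintype V] [DecidableEq V] (G : SimpleGraph V)
    [DecidableRel G.Adj] (S : Finset V) : Finset (Sym2 V) :=
  G.edgeFinset.filter (fun e => ∃ a b, e = s(a, b) ∧ a ∈ S ∧ b ∉ S)

/-- `c_S(v)`: the number of edges of the cut `C(S)` incident to the vertex `v`. -/
def SimpleGraph.cutInc {V : Type*} [Fintype V] [DecidableEq V] (G : SimpleGraph V)
    [DecidableRel G.Adj] (S : Finset V) (v : V) : ℕ :=
  ((G.cutEdges S).filter (fun e => v ∈ e)).card

namespace SimpleGraph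

variable {V : Type*} [Fintype V] [DecidableEq V] (G : SimpleGraph V) [DecidableRel G.Adj]

theorem mk_mem_cutEdges {S : Finset V} {a b : V} :
    s(a, b) ∈ G.cutEdges S ↔ G.Adj a b ∧ (a ∈ S ∧ b ∉ S ∨ b ∈ S ∧ a ∉ S) := by
  simp only [cutEdges, Finset.mem_filter, mem_edgeFinset, mem_edgeSet, Sym2.eq_iff]
  refine and_congr_right fun _ => ⟨?_, ?_⟩
  · rintro ⟨x, y, ⟨rfl, rfl⟩ | ⟨rfl, rfl⟩, h⟩
    exacts [.inl h, .inr h]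
  · rintro (h | h)
    exacts [⟨a, b, .inl ⟨rfl, rfl⟩, h⟩, ⟨b, a, .inr ⟨rfl, rfl⟩, h⟩]

theorem mk_mem_incidenceFinset {v a b : V} :
    s(a, b) ∈ G.incidenceFinset v ↔ G.Adj a b ∧ (v = a ∨ v = b) := by
  simp [incidenceSet]

theorem cutEdges_singleton (v : V) : G.cutEdges {v} = G.incidenceFinset v := by
  ext e
  induction e with | _ a b
  rw [mk_mem_cutEdges, mk_mem_incidenceFinset]
  refine and_congr_right fun h => ?_
  have := h.ne
  grind

theorem cutInc_eq_card_inter (S : Finset V) (v : V) :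
    G.cutInc S v = (G.cutEdges S ∩ G.incidenceFinset v).card := by
  unfold cutInc
  congr 1
  ext e
  induction e with | _ a b
  simp only [Finset.mem_filter, Finset.mem_inter, mk_mem_cutEdges, mk_mem_incidenceFinset,
    Sym2.mem_iff]
  tauto

/-- Moving `v` out of `S` exchanges the cut and non-cut edges at `v`. -/
theorem cutEdges_erase {S : Finset V} {v : V} (hv : v ∈ S) :
    G.cutEdges (S.erase v) =
      G.cutEdges S \ G.incidenceFinset v ∪ G.incidenceFinset v \ G.cutEdges S := by
  ext e
  induction e with | _ a b
  simp only [Finset.mem_union, Finset.mem_sdiff, mk_mem_cutEdges, mk_mem_incidenceFinset,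
    Finset.mem_erase]
  by_cases h : G.Adj a b
  · have := h.ne
    grind
  · simp [h]

theorem card_cutEdges_erase_add {S : Finset V} {v : V} (hv : v ∈ S) :
    (G.cutEdges (S.erase v)).card + 2 * G.cutInc S v = (G.cutEdges S).card + G.degree v := by
  rw [cutEdges_erase G hv, Finset.card_union_of_disjoint disjoint_sdiff_sdiff,
    cutInc_eq_card_inter, ← card_incidenceFinset_eq_degree]
  have h₁ := Finset.card_sdiff_add_card_inter (G.cutEdges S) (G.incidenceFinset v)
  have h₂ := Finset.card_sdiff_add_card_inter (G.incidenceFinset v) (G.cutEdges S)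
  rw [Finset.inter_comm] at h₂
  lia

end SimpleGraph

/-- If every nonempty proper cut has at least `λ` edges and `S` defines a non-singleton
`(2-ε)`-minimum cut, then for every `v ∈ S` we have `2 c_S(v) ≤ (1-ε) λ + d(v)` and
consequently `c_S(v) ≤ (1 - ε/2) d(v)`. -/
theorem cutInc_le_of_near_min_cut {V : Type*} [Fintype V] [DecidableEq V]
    (G : SimpleGraph V) [DecidableRel G.Adj]
    (hn : 4 ≤ Fintype.card V) (lam : ℝ) (hlam : 1 ≤ lam)
    (hmin : ∀ S' : Finset V, S'.Nonempty → S' ≠ Finset.univ →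
      lam ≤ ((G.cutEdges S').card : ℝ))
    (ε : ℝ) (hε0 : 0 < ε) (hε1 : ε ≤ 1)
    (S : Finset V) (hS2 : 2 ≤ S.card) (hSV : S ≠ Finset.univ)
    (hcut : ((G.cutEdges S).card : ℝ) ≤ (2 - ε) * lam) :
    ∀ v ∈ S, 2 * (G.cutInc S v : ℝ) ≤ (1 - ε) * lam + (G.degree v : ℝ) ∧
      (G.cutInc S v : ℝ) ≤ (1 - ε / 2) * (G.degree v : ℝ) := by
  intro v hv
  have hdeg : lam ≤ G.degree v := by
    have h := hmin {v} (Finset.singleton_nonempty v) fun h => by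
      have := congrArg Finset.card h
      rw [Finset.card_singleton, Finset.card_univ] at this
      lia
    rwa [G.cutEdges_singleton, G.card_incidenceFinset_eq_degree] at h
  have herase : lam ≤ (G.cutEdges (S.erase v)).card := by
    refine hmin _ ?_ fun h => Finset.notMem_erase v S (h ▸ Finset.mem_univ v)
    rw [← Finset.card_pos, Finset.card_erase_of_mem hv]
    lia
  have hcard : ((G.cutEdges (S.erase v)).card : ℝ) + 2 * G.cutInc S v =
      (G.cutEdges S).card + G.degree v := mod_cast G.card_cutEdges_erase_add hv
  have hbound : 2 * (G.cutInc S v : ℝ) ≤ (1 - ε) * lam + G.degree v := by linarith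
  refine ⟨hbound, ?_⟩
  have := mul_le_mul_of_nonneg_left hdeg (sub_nonneg.2 hε1)
  linarith
end

section
/- Let G be a finite simple graph with vertex set V of size n ≥ 4, let λ ≥ 1 be a real number such that every nonempty proper subset S' of V satisfies |C(S')| ≥ λ, and let ε ∈ (0,1] be a real number. Let S ⊆ V with 2 ≤ |S| ≤ n - 2 and |C(S)| ≤ (2-ε)·λ. Then ∏_{v ∈ V} (1 - c_S(v)/d(v)) ≥ exp(-4(2-ε)/ε). -/
namespace SimpleGraph

variable {V : Type*} [Fintype V] [DecidableEq V] (G : SimpleGraph V) [DecidableRel G.Adj]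

theorem mk_mem_cutEdges_iff (S : Finset V) (a b : V) :
    s(a, b) ∈ G.cutEdges S ↔ G.Adj a b ∧ (a ∈ S ↔ b ∉ S) := by
  simp only [cutEdges, Finset.mem_filter, mem_edgeFinset, mem_edgeSet, Sym2.eq_iff]
  refine and_congr_right fun _ => ⟨?_, fun h => ?_⟩
  · rintro ⟨x, y, ⟨rfl, rfl⟩ | ⟨rfl, rfl⟩, hx, hy⟩ <;> tauto
  · by_cases ha : a ∈ S
    · exact ⟨a, b, by simp, ha, h.1 ha⟩
    · exact ⟨b, a, by simp, by tauto, ha⟩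

theorem filter_mem_cutEdges_subset_incidenceFinset (S : Finset V) (v : V) :
    (G.cutEdges S).filter (fun e => v ∈ e) ⊆ G.incidenceFinset v := by
  intro e he
  rw [Finset.mem_filter] at he
  rw [mem_incidenceFinset]
  exact ⟨mem_edgeFinset.1 (Finset.mem_filter.1 he.1).1, he.2⟩

theorem cutInc_le_degree (S : Finset V) (v : V) : G.cutInc S v ≤ G.degree v := by
  rw [← card_incidenceFinset_eq_degree]
  exact Finset.card_le_card (G.filter_mem_cutEdges_subset_incidenceFinset S v)

theorem card_cutEdges_singleton_le_degree (v : V) :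
    (G.cutEdges {v}).card ≤ G.degree v := by
  rw [← card_incidenceFinset_eq_degree]
  refine Finset.card_le_card fun e => ?_
  induction e with | _ a b
  rw [mk_mem_cutEdges_iff, mem_incidenceFinset, mk'_mem_incidenceSet_iff]
  simp only [Finset.mem_singleton]
  grind

/-- Moving one vertex `v` across the cut exchanges the cut edges at `v` with the others at `v`. -/
theorem card_cutEdges_add_two_mul_cutInc_le {S T : Finset V} {v : V}
    (hv : v ∈ T ↔ v ∉ S) (hne : ∀ a, a ≠ v → (a ∈ T ↔ a ∈ S)) :
    (G.cutEdges T).card + 2 * G.cutInc S v ≤ (G.cutEdges S).card + G.degree v := by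
  have hsub : G.cutEdges T ⊆ (G.cutEdges S).filter (fun e => v ∉ e) ∪
      (G.incidenceFinset v \ (G.cutEdges S).filter (fun e => v ∈ e)) := by
    intro e
    induction e with | _ a b
    simp only [Finset.mem_union, Finset.mem_sdiff, Finset.mem_filter, mk_mem_cutEdges_iff,
      mem_incidenceFinset, mk'_mem_incidenceSet_iff, Sym2.mem_iff]
    rintro ⟨hab, h⟩
    have := hab.ne
    have ha := hne a
    have hb := hne b
    by_cases hav : v = a
    · subst hav
      grind
    · by_cases hbv : v = b
      · subst hbv
        grind
      · grind
  have h1 := (Finset.card_le_card hsub).trans (Finset.card_union_le _ _)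
  rw [Finset.card_sdiff_of_subset (G.filter_mem_cutEdges_subset_incidenceFinset S v),
    card_incidenceFinset_eq_degree] at h1
  have h2 := Finset.card_filter_add_card_filter_not (s := G.cutEdges S) (fun e => v ∈ e)
  have h3 := G.cutInc_le_degree S v
  unfold cutInc at h3 ⊢
  omega

theorem sum_cutInc (S : Finset V) : ∑ v, G.cutInc S v = 2 * (G.cutEdges S).card := by
  unfold cutInc
  have h := Finset.sum_card_bipartiteAbove_eq_sum_card_bipartiteBelow
    (s := Finset.univ) (t := G.cutEdges S) (fun (v : V) (e : Sym2 V) => v ∈ e)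
  simp only [Finset.bipartiteAbove, Finset.bipartiteBelow] at h
  rw [h, Finset.sum_const_nat (m := 2), mul_comm]
  intro e he
  induction e with | _ a b
  have hab := ((G.mk_mem_cutEdges_iff S a b).1 he).1.ne
  rw [← Finset.card_pair hab]
  congr 1
  ext x
  simp

theorem exists_move_vertex {S : Finset V} (hS : 2 ≤ S.card)
    (hS' : S.card ≤ Fintype.card V - 2) (v : V) :
    ∃ T : Finset V, T.Nonempty ∧ T ≠ Finset.univ ∧ (v ∈ T ↔ v ∉ S) ∧
      ∀ a, a ≠ v → (a ∈ T ↔ a ∈ S) := by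
  by_cases hv : v ∈ S
  · refine ⟨S.erase v, ?_, ?_, by simp [hv], fun a ha => by simp [ha]⟩
    · rw [← Finset.card_pos, Finset.card_erase_of_mem hv]
      omega
    · exact fun h => Finset.notMem_erase v S (h ▸ Finset.mem_univ v)
  · refine ⟨insert v S, Finset.insert_nonempty v S, fun h => ?_, by simp [hv],
      fun a ha => by simp [ha]⟩
    have := congrArg Finset.card h
    rw [Finset.card_insert_of_notMem hv, Finset.card_univ] at this
    omega

end SimpleGraph

theorem Real.exp_neg_div_le_one_sub {x δ : ℝ} (hx : 0 ≤ x) (hδ : 0 < δ) (h : x ≤ 1 - δ) :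
    Real.exp (-(x / δ)) ≤ 1 - x := by
  have hpos : 0 < 1 - x := by linarith
  rw [Real.exp_neg]
  refine inv_le_of_inv_le₀ hpos (le_trans ?_ (Real.add_one_le_exp (x / δ)))
  rw [inv_le_iff_one_le_mul₀ hpos, div_add_one hδ.ne', div_mul_eq_mul_div, le_div_iff₀ hδ]
  nlinarith

/-- Analytic core of Lemma 2.9: for a non-singleton `(2-ε)`-minimum cut `C(S)`,
`∏_{v ∈ V} (1 - c_S(v)/d(v)) ≥ exp (-4(2-ε)/ε)`. -/
theorem prod_one_sub_cutInc_div_degree_ge {V : Type*} [Fintype V] [DecidableEq V]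
    (G : SimpleGraph V) [DecidableRel G.Adj]
    (hn : 4 ≤ Fintype.card V) (lam : ℝ) (hlam : 1 ≤ lam)
    (hmin : ∀ S' : Finset V, S'.Nonempty → S' ≠ Finset.univ →
      lam ≤ ((G.cutEdges S').card : ℝ))
    (ε : ℝ) (hε0 : 0 < ε) (hε1 : ε ≤ 1)
    (S : Finset V) (hS2 : 2 ≤ S.card) (hS2' : S.card ≤ Fintype.card V - 2)
    (hcut : ((G.cutEdges S).card : ℝ) ≤ (2 - ε) * lam) :
    ∏ v : V, (1 - (G.cutInc S v : ℝ) / (G.degree v : ℝ)) ≥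
      Real.exp (-4 * (2 - ε) / ε) := by
  have hd : ∀ v, lam ≤ (G.degree v : ℝ) := fun v =>
    (hmin {v} (Finset.singleton_nonempty v) fun h => by
      have := congrArg Finset.card h
      rw [Finset.card_singleton, Finset.card_univ] at this
      omega).trans (by exact_mod_cast G.card_cutEdges_singleton_le_degree v)
  have hfactor : ∀ v, Real.exp (-((G.cutInc S v : ℝ) / G.degree v / (ε / 2))) ≤
      1 - (G.cutInc S v : ℝ) / G.degree v := by
    intro v
    have hdv := hd v
    have hpos : (0 : ℝ) < G.degree v := by linarith
    obtain ⟨T, hT, hT', hvT, hne⟩ := SimpleGraph.exists_move_vertex hS2 hS2' v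
    have hlamT := hmin T hT hT'
    have hmove : ((G.cutEdges T).card : ℝ) + 2 * G.cutInc S v ≤
        (G.cutEdges S).card + G.degree v := by
      exact_mod_cast G.card_cutEdges_add_two_mul_cutInc_le hvT hne
    refine Real.exp_neg_div_le_one_sub (by positivity) (by positivity) ?_
    rw [div_le_iff₀ hpos]
    nlinarith [mul_le_mul_of_nonneg_left hdv (sub_nonneg.2 hε1)]
  have hsum : ∑ v, (G.cutInc S v : ℝ) / G.degree v ≤ 2 * (2 - ε) := by
    have htotal : ∑ v, (G.cutInc S v : ℝ) = 2 * (G.cutEdges S).card := by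
      exact_mod_cast G.sum_cutInc S
    calc ∑ v, (G.cutInc S v : ℝ) / G.degree v ≤ ∑ v, (G.cutInc S v : ℝ) / lam := by
          gcongr with v
          exact hd v
      _ ≤ 2 * (2 - ε) := by
          rw [← Finset.sum_div, htotal, div_le_iff₀ (by linarith)]
          linarith
  calc Real.exp (-4 * (2 - ε) / ε)
      ≤ Real.exp (∑ v, -((G.cutInc S v : ℝ) / G.degree v / (ε / 2))) := by
        rw [Real.exp_le_exp, Finset.sum_neg_distrib, ← Finset.sum_div,
          show -4 * (2 - ε) / ε = -(2 * (2 - ε) / (ε / 2)) by field_simp; ring]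
        gcongr
    _ = ∏ v, Real.exp (-((G.cutInc S v : ℝ) / G.degree v / (ε / 2))) := Real.exp_sum _ _
    _ ≤ ∏ v, (1 - (G.cutInc S v : ℝ) / G.degree v) :=
        Finset.prod_le_prod (fun _ _ => (Real.exp_pos _).le) fun v _ => hfactor v
end

section
/- For every natural number x ≥ 2, one has C(2x+2, x+2) · x^{x+2} < 4·e³·x · C(2x, x+1) · (x-1)^{x+1}, where C(n,k) denotes the binomial coefficient. -/
theorem mul_choose_two_mul_add_two (x : ℕ) :
    x * (x + 2) * (2 * x + 2).choose (x + 2) =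
      (2 * x + 2) * (2 * x + 1) * (2 * x).choose (x + 1) := by
  have h₁ : (2 * x + 2) * (2 * x + 1).choose (x + 1) =
      (2 * x + 2).choose (x + 2) * (x + 2) := Nat.add_one_mul_choose_eq (2 * x + 1) (x + 1)
  have h₂ := Nat.choose_mul_succ_eq (2 * x) (x + 1)
  rw [show 2 * x + 1 - (x + 1) = x by omega] at h₂
  calc x * (x + 2) * (2 * x + 2).choose (x + 2)
      = x * ((2 * x + 2).choose (x + 2) * (x + 2)) := by ring
    _ = (2 * x + 2) * ((2 * x + 1).choose (x + 1) * x) := by rw [← h₁]; ring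
    _ = (2 * x + 2) * (2 * x + 1) * (2 * x).choose (x + 1) := by rw [← h₂]; ring

theorem choose_two_mul_add_two_lt {x : ℕ} (hx : 2 ≤ x) :
    (2 * x + 2).choose (x + 2) < 4 * (2 * x).choose (x + 1) := by
  have hc : 0 < (2 * x).choose (x + 1) := Nat.choose_pos (by omega)
  refine Nat.lt_of_mul_lt_mul_left (a := x * (x + 2)) ?_
  rw [mul_choose_two_mul_add_two, ← mul_assoc]
  exact Nat.mul_lt_mul_of_pos_right (by nlinarith) hc

theorem pow_le_exp_three_mul_sub_one_pow {x : ℕ} (hx : 2 ≤ x) :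
    (x : ℝ) ^ (x + 1) ≤ Real.exp 3 * ((x : ℝ) - 1) ^ (x + 1) := by
  have hx' : (2 : ℝ) ≤ x := by exact_mod_cast hx
  have hpos : 0 < (x : ℝ) - 1 := by linarith
  have hbase : (x : ℝ) ≤ Real.exp (1 / ((x : ℝ) - 1)) * ((x : ℝ) - 1) :=
    calc (x : ℝ) = (1 / ((x : ℝ) - 1) + 1) * ((x : ℝ) - 1) := by field_simp; ring
      _ ≤ _ := by gcongr; exact Real.add_one_le_exp _
  calc (x : ℝ) ^ (x + 1) ≤ (Real.exp (1 / ((x : ℝ) - 1)) * ((x : ℝ) - 1)) ^ (x + 1) := by gcongr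
    _ = Real.exp (((x + 1 : ℕ) : ℝ) * (1 / ((x : ℝ) - 1))) * ((x : ℝ) - 1) ^ (x + 1) := by
      rw [mul_pow, Real.exp_nat_mul]
    _ ≤ _ := by
      gcongr
      rw [mul_one_div, div_le_iff₀ hpos]
      push_cast
      linarith

/-- Ratio bound from Lemma 2.5: for `x ≥ 2`,
`C(2x+2, x+2) · x^(x+2) < 4e³·x · C(2x, x+1) · (x-1)^(x+1)`. -/
theorem choose_ratio_bound (x : ℕ) (hx : 2 ≤ x) :
    ((2 * x + 2).choose (x + 2) : ℝ) * (x : ℝ) ^ (x + 2) <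
      4 * Real.exp 3 * (x : ℝ) * ((2 * x).choose (x + 1) : ℝ) * ((x : ℝ) - 1) ^ (x + 1) := by
  have hc : ((2 * x + 2).choose (x + 2) : ℝ) < 4 * ((2 * x).choose (x + 1) : ℝ) := by
    exact_mod_cast choose_two_mul_add_two_lt hx
  have hx₀ : (0 : ℝ) < x := by exact_mod_cast (by omega : 0 < x)
  calc ((2 * x + 2).choose (x + 2) : ℝ) * (x : ℝ) ^ (x + 2)
      < 4 * ((2 * x).choose (x + 1) : ℝ) * (x : ℝ) ^ (x + 2) := by gcongr
    _ = 4 * ((2 * x).choose (x + 1) : ℝ) * x * (x : ℝ) ^ (x + 1) := by ring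
    _ ≤ 4 * ((2 * x).choose (x + 1) : ℝ) * x * (Real.exp 3 * ((x : ℝ) - 1) ^ (x + 1)) := by
      gcongr ?_ * ?_
      exact pow_le_exp_three_mul_sub_one_pow hx
    _ = _ := by ring
end

section
/- Let δ > 0 be a real number and let N be a natural number with N ≤ δ/(8e³). Then ∑_{x=2}^{N} C(2x, x+1)·((x-1)/δ)^{x+1} ≤ 8/δ³, where C(n,k) denotes the binomial coefficient. -/
theorem choose_two_mul_add_two_le {x : ℕ} (hx : 1 ≤ x) :
    (2 * (x + 1)).choose (x + 1 + 1) ≤ 4 * (2 * x).choose (x + 1) := by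
  have h1 := Nat.add_one_mul_choose_eq (2 * x + 1) (x + 1)
  have h2 := Nat.choose_mul_succ_eq (2 * x) (x + 1)
  rw [show 2 * x + 1 - (x + 1) = x by omega] at h2
  rw [show 2 * (x + 1) = 2 * x + 1 + 1 by ring]
  have h3 : (x * (x + 2)) * (2 * x + 1 + 1).choose (x + 1 + 1) =
      ((2 * x + 2) * (2 * x + 1)) * (2 * x).choose (x + 1) := by
    zify at h1 h2 ⊢
    linear_combination -(x : ℤ) * h1 - (2 * x + 2) * h2
  refine Nat.le_of_mul_le_mul_left (c := x * (x + 2)) ?_ (by positivity)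
  rw [h3, ← mul_assoc]
  exact Nat.mul_le_mul_right _ (by nlinarith)

theorem succ_pow_le_exp_three_mul_pow {m : ℕ} (hm : 1 ≤ m) :
    ((m : ℝ) + 1) ^ (m + 2) ≤ Real.exp 3 * (m : ℝ) ^ (m + 2) := by
  have hm' : (1 : ℝ) ≤ m := by exact_mod_cast hm
  have hpos : (0 : ℝ) < m := by linarith
  have h : (m : ℝ) + 1 ≤ Real.exp (1 / m) * m := by
    calc (m : ℝ) + 1 = (1 / m + 1) * m := by field_simp; ring
      _ ≤ Real.exp (1 / m) * m := by gcongr; exact Real.add_one_le_exp _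
  calc ((m : ℝ) + 1) ^ (m + 2) ≤ (Real.exp (1 / m) * m) ^ (m + 2) := by gcongr
    _ = Real.exp (((m + 2 : ℕ) : ℝ) * (1 / m)) * (m : ℝ) ^ (m + 2) := by
      rw [mul_pow, Real.exp_nat_mul]
    _ ≤ Real.exp 3 * (m : ℝ) ^ (m + 2) := by
      gcongr
      rw [mul_one_div, div_le_iff₀ hpos]
      push_cast
      linarith

theorem two_mul_choose_mul_pow_succ_le {δ : ℝ} (hδ : 0 < δ) {x : ℕ} (hx : 2 ≤ x)
    (hxδ : (x : ℝ) ≤ δ / (8 * Real.exp 3)) :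
    2 * (((2 * (x + 1)).choose (x + 1 + 1) : ℝ) *
        ((((x + 1 : ℕ) : ℝ) - 1) / δ) ^ (x + 1 + 1)) ≤
      ((2 * x).choose (x + 1) : ℝ) * (((x : ℝ) - 1) / δ) ^ (x + 1) := by
  obtain ⟨m, rfl⟩ : ∃ m, x = m + 1 := ⟨x - 1, by omega⟩
  have hc : ((2 * (m + 1 + 1)).choose (m + 1 + 1 + 1) : ℝ) ≤
      4 * (2 * (m + 1)).choose (m + 1 + 1) := by
    exact_mod_cast choose_two_mul_add_two_le (x := m + 1) (by omega)
  have hp := succ_pow_le_exp_three_mul_pow (m := m) (by omega)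
  rw [le_div_iff₀ (by positivity)] at hxδ
  push_cast at hxδ ⊢
  simp only [add_sub_cancel_right, div_pow]
  generalize ((2 * (m + 1 + 1)).choose (m + 1 + 1 + 1) : ℝ) = A at *
  have hB : (0 : ℝ) ≤ ((2 * (m + 1)).choose (m + 1 + 1) : ℝ) := by positivity
  generalize ((2 * (m + 1)).choose (m + 1 + 1) : ℝ) = B at *
  calc 2 * (A * (((m : ℝ) + 1) ^ (m + 1 + 1 + 1) / δ ^ (m + 1 + 1 + 1)))
      ≤ 2 * ((4 * B) * ((Real.exp 3 * (m : ℝ) ^ (m + 2)) * ((m : ℝ) + 1) /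
          δ ^ (m + 1 + 1 + 1))) := by
        rw [pow_succ ((m : ℝ) + 1)]
        gcongr
    _ = B * ((m : ℝ) ^ (m + 2) / δ ^ (m + 2)) *
          ((((m : ℝ) + 1) * (8 * Real.exp 3)) / δ) := by
        field_simp
        ring
    _ ≤ B * ((m : ℝ) ^ (m + 2) / δ ^ (m + 2)) * 1 := by
        gcongr
        rwa [div_le_one hδ]
    _ = _ := by ring

/-- A finite sum whose terms at least halve at each step is at most twice its first term. -/
theorem sum_Icc_le_two_mul_of_two_mul_succ_le {f : ℕ → ℝ} {a n : ℕ} (han : a ≤ n)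
    (h : ∀ x, a ≤ x → x < n → 2 * f (x + 1) ≤ f x) :
    ∑ x ∈ Finset.Icc a n, f x + f n ≤ 2 * f a := by
  induction n, han using Nat.le_induction with
  | base => simp [two_mul]
  | succ k hk ih =>
    rw [Finset.sum_Icc_succ_top (by omega)]
    linarith [ih fun x hx hxk => h x hx (by omega), h k hk (by omega)]

/-- Lemma 2.5, summed form: if `N ≤ δ/(8e³)` then
`∑_{x=2}^{N} C(2x, x+1)·((x-1)/δ)^(x+1) ≤ 8/δ³`. -/
theorem sum_P_le (δ : ℝ) (hδ : 0 < δ) (N : ℕ) (hN : (N : ℝ) ≤ δ / (8 * Real.exp 3)) :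
    ∑ x ∈ Finset.Icc 2 N, ((2 * x).choose (x + 1) : ℝ) * (((x : ℝ) - 1) / δ) ^ (x + 1) ≤
      8 / δ ^ 3 := by
  rcases lt_or_ge N 2 with h | h
  · rw [Finset.Icc_eq_empty (by omega), Finset.sum_empty]
    positivity
  have key := sum_Icc_le_two_mul_of_two_mul_succ_le
    (f := fun x : ℕ => ((2 * x).choose (x + 1) : ℝ) * (((x : ℝ) - 1) / δ) ^ (x + 1)) h
    fun x hx hxN => two_mul_choose_mul_pow_succ_le hδ hx
      (le_trans (by exact_mod_cast hxN.le) hN)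
  have hfirst : 2 * (((2 * 2).choose (2 + 1) : ℝ) * ((((2 : ℕ) : ℝ) - 1) / δ) ^ (2 + 1)) =
      8 / δ ^ 3 := by
    norm_num [Nat.choose, div_pow]
    ring
  have hlast : 0 ≤ ((2 * N).choose (N + 1) : ℝ) * (((N : ℝ) - 1) / δ) ^ (N + 1) := by
    have : (0 : ℝ) ≤ (N : ℝ) - 1 := by
      have : (2 : ℝ) ≤ N := by exact_mod_cast h
      linarith
    positivity
  linarith
end
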